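/- arXiv:1510.08955 — 2 statements merged into one kernel-verified Lean document; each statement's English description precedes it below -/
import Mathlib

section
/- Let f₁, g₁, f₂, g₂ : ℤ → R and let G : ℤ → R satisfy G(n+1) - G(n) = g₁(n)f₂(n) for all n ∈ ℤ. Then, as R-linear operators on V, M_{f₁}∘J∘M_{g₁}∘M_{f₂}∘J∘M_{g₂} = M_{f₁·G}∘J∘M_{g₂} - M_{f₁}∘J∘M_{(ΛG)·g₂}. (This is the product formula f₁Δ⁻¹g₁ ∘ f₂Δ⁻¹g₂ = f₁(Δ⁻¹(g₁f₂))Δ⁻¹g₂ - f₁Δ⁻¹∘Λ(Δ⁻¹(g₁f₂))g₂ used for composing pseudo-difference dressing operators.) -/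
open Finset

/-- A function `ℤ → R` has support bounded below. -/
def SuppBddBelow {A : Type*} [Zero A] (f : ℤ → A) : Prop :=
  ∃ M : ℤ, ∀ n : ℤ, n < M → f n = 0

/-- The shift operator `(Λ f)(n) = f(n+1)`. -/
def shiftL {A : Type*} (f : ℤ → A) : ℤ → A := fun n => f (n + 1)

/-- The summation operator `(J f)(n) = ∑_{m < n} f(m)` (a finite sum when the
support of `f` is bounded below, realized via `finsum`). -/
noncomputable def Jop {A : Type*} [AddCommMonoid A] (f : ℤ → A) : ℤ → A :=
  fun n => ∑ᶠ (m : ℤ) (_ : m < n), f m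

theorem Jop_eq_zero_of_le {A : Type*} [AddCommMonoid A] {f : ℤ → A} {M n : ℤ}
    (hf : ∀ m < M, f m = 0) (hn : n ≤ M) : Jop f n = 0 :=
  finsum_mem_eq_zero_of_forall_eq_zero (s := {m | m < n}) fun m hm =>
    hf m (lt_of_lt_of_le hm hn)

theorem Jop_succ {A : Type*} [AddCommMonoid A] {f : ℤ → A} (hf : SuppBddBelow f) (n : ℤ) :
    Jop f (n + 1) = f n + Jop f n := by
  obtain ⟨M, hM⟩ := hf
  have hset : {m : ℤ | m < n + 1} = insert n {m | m < n} := by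
    ext m
    simp only [Set.mem_ofPred_eq, Set.mem_insert_iff]
    omega
  change ∑ᶠ m ∈ {m : ℤ | m < n + 1}, f m = f n + ∑ᶠ m ∈ {m : ℤ | m < n}, f m
  rw [hset]
  refine finsum_mem_insert' f (lt_irrefl n) ((Set.finite_Ico M n).subset ?_)
  rintro m ⟨hmn, hm⟩
  exact ⟨not_lt.mp fun h => hm (hM m h), hmn⟩

/-- `J` inverts the difference operator on functions with support bounded below. -/
theorem Jop_eq_of_forward_difference {A : Type*} [AddCommMonoid A] {f F : ℤ → A}
    (hF : SuppBddBelow F) (hf : SuppBddBelow f) (hstep : ∀ n, F (n + 1) = f n + F n) (n : ℤ) :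
    Jop f n = F n := by
  obtain ⟨M, hM⟩ := hF
  obtain ⟨N, hN⟩ := hf
  have hbase : ∀ n ≤ min (M - 1) N, Jop f n = F n := fun n hn => by
    rw [Jop_eq_zero_of_le hN (by omega), hM n (by omega)]
  rcases le_total n (min (M - 1) N) with hn | hn
  · exact hbase n hn
  · induction n, hn using Int.leInduction with
    | base => exact hbase _ le_rfl
    | succ n _ ih => rw [Jop_succ ⟨N, hN⟩, hstep, ih]

/-- if `G(n+1) - G(n) = g₁(n) f₂(n)` for all `n`, then as operators on
functions with support bounded below,
`M_{f₁}∘J∘M_{g₁}∘M_{f₂}∘J∘M_{g₂} = M_{f₁·G}∘J∘M_{g₂} - M_{f₁}∘J∘M_{(ΛG)·g₂}`. -/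
theorem stmt2 {R : Type*} [CommRing R] (f₁ g₁ f₂ g₂ G : ℤ → R)
    (hG : ∀ n : ℤ, G (n + 1) - G n = g₁ n * f₂ n) :
    ∀ h : ℤ → R, SuppBddBelow h → ∀ n : ℤ,
      f₁ n * Jop (fun k => g₁ k * (f₂ k * Jop (fun j => g₂ j * h j) k)) n
        = (f₁ n * G n) * Jop (fun k => g₂ k * h k) n
            - f₁ n * Jop (fun k => (shiftL G k * g₂ k) * h k) n := by
  rintro h ⟨M, hM⟩ n
  have hM₁ : ∀ k < M, g₂ k * h k = 0 := fun k hk => by rw [hM k hk, mul_zero]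
  have hM₂ : ∀ k < M, (shiftL G k * g₂ k) * h k = 0 := fun k hk => by rw [hM k hk, mul_zero]
  rw [Jop_eq_of_forward_difference (F := fun n => G n * Jop (fun k => g₂ k * h k) n
    - Jop (fun k => (shiftL G k * g₂ k) * h k) n)]
  · ring
  · refine ⟨M, fun k hk => ?_⟩
    simp only [Jop_eq_zero_of_le hM₁ hk.le, Jop_eq_zero_of_le hM₂ hk.le, mul_zero, sub_zero]
  · refine ⟨M, fun k hk => ?_⟩
    simp only [Jop_eq_zero_of_le hM₁ hk.le, mul_zero]
  · intro k
    rw [Jop_succ ⟨M, hM₁⟩, Jop_succ ⟨M, hM₂⟩, show shiftL G k = G (k + 1) from rfl]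
    linear_combination Jop (fun k => g₂ k * h k) k * hG k
end

section
/- Let ψ : ℤ → R and n ≥ 1. Then, as R-linear operators on V, J∘M_ψ∘Δⁿ = Σ_{j=0}^{n-1} M_{Λ⁻¹((Δ*)^j ψ)}∘Δ^{n-1-j} + J∘M_{(Δ*)^n ψ}, where (Δ*ψ)(m) = ψ(m-1) - ψ(m). (This is the peeling computation in the proof of the lemma [Bₙ, φΔ⁻¹ψ]₋ = Bₙ(φ)Δ⁻¹ψ - φΔ⁻¹Bₙ*(ψ): the strictly negative part of Δ⁻¹ψΔⁿ equals Δ⁻¹∘((-ΔΛ⁻¹)ⁿψ).) -/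
open Finset

/-- The inverse shift operator `(Λ⁻¹ f)(n) = f(n-1)`. -/
def shiftLinv {A : Type*} (f : ℤ → A) : ℤ → A := fun n => f (n - 1)

/-- The difference operator `(Δ f)(n) = f(n+1) - f(n)`. -/
def Del {A : Type*} [AddCommGroup A] (f : ℤ → A) : ℤ → A := fun n => f (n + 1) - f n

/-- The formal adjoint of the difference operator, `(Δ* f)(n) = f(n-1) - f(n)`. -/
def DelStar {A : Type*} [AddCommGroup A] (f : ℤ → A) : ℤ → A := fun n => f (n - 1) - f n

theorem SuppBddBelow.del {A : Type*} [AddCommGroup A] {f : ℤ → A} (hf : SuppBddBelow f) :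
    SuppBddBelow (Del f) := by
  obtain ⟨M, hM⟩ := hf
  exact ⟨M - 1, fun n hn => by
    simp [Del, hM n (by omega), hM (n + 1) (by omega)]⟩

theorem SuppBddBelow.iterate_del {A : Type*} [AddCommGroup A] {f : ℤ → A}
    (hf : SuppBddBelow f) (n : ℕ) : SuppBddBelow (Del^[n] f) := by
  induction n with
  | zero => exact hf
  | succ n ih => rw [Function.iterate_succ_apply']; exact ih.del

theorem SuppBddBelow.mul_left {A : Type*} [MulZeroClass A] {f : ℤ → A} (hf : SuppBddBelow f)
    (φ : ℤ → A) : SuppBddBelow (fun m => φ m * f m) := by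
  obtain ⟨M, hM⟩ := hf
  exact ⟨M, fun n hn => by simp [hM n hn]⟩

theorem Jop_eq_sum_Ico {A : Type*} [AddCommMonoid A] {f : ℤ → A} {M : ℤ}
    (hf : ∀ n < M, f n = 0) (k : ℤ) : Jop f k = ∑ m ∈ Finset.Ico M k, f m := by
  refine finsum_mem_eq_sum_of_inter_support_eq (s := Set.Iio k) f ?_
  ext m
  simp only [Set.mem_inter_iff, Set.mem_Iio, Function.mem_support, Finset.coe_Ico, Set.mem_Ico]
  refine ⟨fun ⟨hk, h⟩ => ⟨⟨?_, hk⟩, h⟩, fun ⟨⟨_, hk⟩, h⟩ => ⟨hk, h⟩⟩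
  by_contra hlt
  exact h (hf m (not_le.mp hlt))

theorem Jop_add {A : Type*} [AddCommMonoid A] {f g : ℤ → A} (hf : SuppBddBelow f)
    (hg : SuppBddBelow g) (k : ℤ) : Jop (fun m => f m + g m) k = Jop f k + Jop g k := by
  obtain ⟨M, hM⟩ := hf
  obtain ⟨N, hN⟩ := hg
  have hf' : ∀ n < min M N, f n = 0 := fun n hn => hM n (by omega)
  have hg' : ∀ n < min M N, g n = 0 := fun n hn => hN n (by omega)
  rw [Jop_eq_sum_Ico hf', Jop_eq_sum_Ico hg', ← Finset.sum_add_distrib]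
  exact Jop_eq_sum_Ico (fun n hn => by rw [hf' n hn, hg' n hn, add_zero]) k

theorem sum_Ico_del {A : Type*} [AddCommGroup A] (f : ℤ → A) {a b : ℤ} (hab : a ≤ b) :
    ∑ m ∈ Finset.Ico a b, Del f m = f b - f a := by
  induction b, hab using Int.leInduction with
  | base => simp
  | succ b hab ih =>
    have h : Finset.Ico a (b + 1) = insert b (Finset.Ico a b) := by
      ext m
      simp only [Finset.mem_Ico, Finset.mem_insert]
      omega
    rw [h, Finset.sum_insert (by simp), ih, Del]
    abel

theorem Jop_del {A : Type*} [AddCommGroup A] {f : ℤ → A} (hf : SuppBddBelow f) (k : ℤ) :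
    Jop (Del f) k = f k := by
  obtain ⟨M, hM⟩ := hf
  have h : ∀ n < min (M - 1) k, Del f n = 0 := fun n hn => by
    simp [Del, hM n (by omega), hM (n + 1) (by omega)]
  rw [Jop_eq_sum_Ico h, sum_Ico_del f (min_le_right _ _), hM (min (M - 1) k) (by omega), sub_zero]

/-- Summation by parts: `J∘M_ψ∘Δ = M_{Λ⁻¹ψ} + J∘M_{Δ*ψ}`. -/
theorem Jop_mul_del {R : Type*} [CommRing R] (ψ : ℤ → R) {f : ℤ → R} (hf : SuppBddBelow f)
    (k : ℤ) : Jop (fun m => ψ m * Del f m) k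
      = shiftLinv ψ k * f k + Jop (fun m => DelStar ψ m * f m) k := by
  have h : (fun m => ψ m * Del f m)
      = fun m => Del (fun i => shiftLinv ψ i * f i) m + DelStar ψ m * f m := by
    funext m
    simp only [Del, DelStar, shiftLinv, add_sub_cancel_right]
    ring
  rw [h, Jop_add (hf.mul_left _).del (hf.mul_left _), Jop_del (hf.mul_left _)]

/-- for `n ≥ 1`, as operators on functions with support bounded below,
`J∘M_ψ∘Δⁿ = Σ_{j=0}^{n-1} M_{Λ⁻¹((Δ*)ʲψ)}∘Δ^{n-1-j} + J∘M_{(Δ*)ⁿψ}`. -/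
theorem stmt5 {R : Type*} [CommRing R] (ψ : ℤ → R) (n : ℕ) (hn : 1 ≤ n) :
    ∀ g : ℤ → R, SuppBddBelow g → ∀ k : ℤ,
      Jop (fun j => ψ j * Del^[n] g j) k
        = (∑ j ∈ Finset.range n, shiftLinv (DelStar^[j] ψ) k * Del^[n - 1 - j] g k)
            + Jop (fun j => DelStar^[n] ψ j * g j) k := by
  clear hn
  intro g hg k
  induction n generalizing ψ with
  | zero => simp
  | succ n ih =>
    simp only [Function.iterate_succ_apply' Del]
    rw [Jop_mul_del ψ (hg.iterate_del n), ih (DelStar ψ), Finset.sum_range_succ']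
    simp only [Function.iterate_succ_apply DelStar, Function.iterate_zero, id_eq,
      Nat.add_sub_cancel, Nat.sub_zero, Nat.sub_add_eq, Nat.sub_right_comm n _ 1]
    abel
end
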